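/- For every natural number k, the space V_k is the direct sum of the two eigenspaces E₋ = {σ ∈ V_k : D̄σ = −k·σ} and E₊ = {σ ∈ V_k : D̄σ = (k+2)·σ} of the operator D̄, and their real dimensions are dim_ℝ E₋ = 2(k+1)(k+2) and dim_ℝ E₊ = 2k(k+1). (This encodes the spectrum of the spin Dirac operator 𝒟 = D̄ − 3/2 on the round 3-sphere: eigenvalues −(k+3/2) and k+1/2 with quaternionic multiplicities as stated.) -/

import Mathlib

open Quaternion MvPolynomial

noncomputable section

/-- The standard imaginary quaternion units. -/
def e1 : ℍ[ℝ] := ⟨0, 1, 0, 0⟩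
def e2 : ℍ[ℝ] := ⟨0, 0, 1, 0⟩
def e3 : ℍ[ℝ] := ⟨0, 0, 0, 1⟩

/-- Infinitesimal right translation: `(L_v σ)(x) = Dσ(x)[x·v]`. -/
def Lop (v : ℍ[ℝ]) (σ : ℍ[ℝ] → ℍ[ℝ]) : ℍ[ℝ] → ℍ[ℝ] :=
  fun x => fderiv ℝ σ x (x * v)

/-- The operator `D̄σ = −((L₁σ)·e₁ + (L₂σ)·e₂ + (L₃σ)·e₃)`. -/
def Dbar (σ : ℍ[ℝ] → ℍ[ℝ]) : ℍ[ℝ] → ℍ[ℝ] :=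
  fun x => -(Lop e1 σ x * e1 + Lop e2 σ x * e2 + Lop e3 σ x * e3)

/-- The four real coordinates of a quaternion. -/
def coords (x : ℍ[ℝ]) : Fin 4 → ℝ := ![x.re, x.imI, x.imJ, x.imK]

/-- `σ ∈ V_k`: each of the four real components of `σ` is (given by) a harmonic
polynomial on `ℝ⁴`, homogeneous of degree `k`. -/
def memVk (k : ℕ) (σ : ℍ[ℝ] → ℍ[ℝ]) : Prop :=
  ∀ c : Fin 4, ∃ P : MvPolynomial (Fin 4) ℝ,
    P.IsHomogeneous k ∧ (∑ i : Fin 4, pderiv i (pderiv i P)) = 0 ∧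
    ∀ x : ℍ[ℝ], eval (coords x) P = coords (σ x) c

/-- The eigenspace `E₋ = {σ ∈ V_k : D̄σ = −k·σ}` (as a set). -/
def EminusSet (k : ℕ) : Set (ℍ[ℝ] → ℍ[ℝ]) :=
  {σ | memVk k σ ∧ Dbar σ = (-(k : ℝ)) • σ}

/-- The eigenspace `E₊ = {σ ∈ V_k : D̄σ = (k+2)·σ}` (as a set). -/
def EplusSet (k : ℕ) : Set (ℍ[ℝ] → ℍ[ℝ]) :=
  {σ | memVk k σ ∧ Dbar σ = ((k : ℝ) + 2) • σ}

/-- `V_k` as a set. -/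
def VkSet (k : ℕ) : Set (ℍ[ℝ] → ℍ[ℝ]) := {σ | memVk k σ}


set_option linter.unusedSimpArgs false

/-! ### Polynomial level operators -/

abbrev Pol := MvPolynomial (Fin 4) ℝ

lemma pd_comm (i j : Fin 4) (P : Pol) : pderiv i (pderiv j P) = pderiv j (pderiv i P) := by
  have h : ⁅(pderiv i : Derivation ℝ Pol Pol), (pderiv j : Derivation ℝ Pol Pol)⁆ = 0 := by
    apply MvPolynomial.derivation_ext
    intro l
    rw [Derivation.commutator_apply, pderiv_X, pderiv_X]
    by_cases h1 : l = i <;> by_cases h2 : l = j <;> simp [Pi.single_apply, h1, h2]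
    all_goals (try split_ifs) <;> simp
  have := congrArg (fun E : Derivation ℝ Pol Pol => E P) h
  simp only [Derivation.commutator_apply, Derivation.zero_apply] at this
  exact sub_eq_zero.mp this

/-- The Laplacian. -/
def lap : Pol →ₗ[ℝ] Pol := ∑ i : Fin 4, (pderiv i).toLinearMap ∘ₗ (pderiv i).toLinearMap

lemma lap_apply (P : Pol) : lap P = ∑ i : Fin 4, pderiv i (pderiv i P) := by
  simp [lap]

/-- multiplication by a variable followed by partial derivative. -/
def xd (i j : Fin 4) : Pol →ₗ[ℝ] Pol := LinearMap.mulLeft ℝ (X i) ∘ₗ (pderiv j).toLinearMap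

lemma xd_apply (i j : Fin 4) (P : Pol) : xd i j P = X i * pderiv j P := rfl

def A1 : Pol →ₗ[ℝ] Pol := - xd 1 0 + xd 0 1 + xd 3 2 - xd 2 3
def A2 : Pol →ₗ[ℝ] Pol := - xd 2 0 - xd 3 1 + xd 0 2 + xd 1 3
def A3 : Pol →ₗ[ℝ] Pol := - xd 3 0 + xd 2 1 - xd 1 2 + xd 0 3

lemma A1_apply (P : Pol) : A1 P = - (X 1 * pderiv 0 P) + X 0 * pderiv 1 P + X 3 * pderiv 2 P
    - X 2 * pderiv 3 P := rfl
lemma A2_apply (P : Pol) : A2 P = - (X 2 * pderiv 0 P) - X 3 * pderiv 1 P + X 0 * pderiv 2 P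
    + X 1 * pderiv 3 P := rfl
lemma A3_apply (P : Pol) : A3 P = - (X 3 * pderiv 0 P) + X 2 * pderiv 1 P - X 1 * pderiv 2 P
    + X 0 * pderiv 3 P := rfl

lemma pd_X_mul (i j : Fin 4) (P : Pol) :
    pderiv i (X j * P) = (if i = j then P else 0) + X j * pderiv i P := by
  rw [Derivation.leibniz, pderiv_X]
  by_cases h : i = j
  · subst h; simp [add_comm]
  · simp [h, Ne.symm h]

lemma A12 (P : Pol) : A1 (A2 P) - A2 (A1 P) = 2 * A3 P := by
  simp only [A1_apply, A2_apply, A3_apply, map_add, map_sub, map_neg, pd_X_mul,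
    pd_comm 1 0, pd_comm 2 0, pd_comm 3 0, pd_comm 2 1, pd_comm 3 1, pd_comm 3 2, Fin.reduceEq,
    if_true, if_false]
  ring

lemma A23 (P : Pol) : A2 (A3 P) - A3 (A2 P) = 2 * A1 P := by
  simp only [A1_apply, A2_apply, A3_apply, map_add, map_sub, map_neg, pd_X_mul,
    pd_comm 1 0, pd_comm 2 0, pd_comm 3 0, pd_comm 2 1, pd_comm 3 1, pd_comm 3 2, Fin.reduceEq,
    if_true, if_false]
  ring

lemma A31 (P : Pol) : A3 (A1 P) - A1 (A3 P) = 2 * A2 P := by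
  simp only [A1_apply, A2_apply, A3_apply, map_add, map_sub, map_neg, pd_X_mul,
    pd_comm 1 0, pd_comm 2 0, pd_comm 3 0, pd_comm 2 1, pd_comm 3 1, pd_comm 3 2, Fin.reduceEq,
    if_true, if_false]
  ring

lemma Asq (P : Pol) : A1 (A1 P) + A2 (A2 P) + A3 (A3 P) =
    (X 0 ^ 2 + X 1 ^ 2 + X 2 ^ 2 + X 3 ^ 2) * lap P
    - ∑ i, X i * pderiv i (∑ j, X j * pderiv j P) - 2 * ∑ j, X j * pderiv j P := by
  simp only [A1_apply, A2_apply, A3_apply, map_add, map_sub, map_neg, pd_X_mul, lap_apply,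
    Fin.sum_univ_four,
    pd_comm 1 0, pd_comm 2 0, pd_comm 3 0, pd_comm 2 1, pd_comm 3 1, pd_comm 3 2, Fin.reduceEq,
    if_true, if_false]
  ring

lemma lap_A1 (P : Pol) : lap (A1 P) = A1 (lap P) := by
  simp only [A1_apply, map_add, map_sub, map_neg, pd_X_mul, lap_apply, Fin.sum_univ_four,
    pd_comm 1 0, pd_comm 2 0, pd_comm 3 0, pd_comm 2 1, pd_comm 3 1, pd_comm 3 2, Fin.reduceEq,
    if_true, if_false, map_zero]
  ring
lemma lap_A2 (P : Pol) : lap (A2 P) = A2 (lap P) := by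
  simp only [A2_apply, map_add, map_sub, map_neg, pd_X_mul, lap_apply, Fin.sum_univ_four,
    pd_comm 1 0, pd_comm 2 0, pd_comm 3 0, pd_comm 2 1, pd_comm 3 1, pd_comm 3 2, Fin.reduceEq,
    if_true, if_false, map_zero]
  ring
lemma lap_A3 (P : Pol) : lap (A3 P) = A3 (lap P) := by
  simp only [A3_apply, map_add, map_sub, map_neg, pd_X_mul, lap_apply, Fin.sum_univ_four,
    pd_comm 1 0, pd_comm 2 0, pd_comm 3 0, pd_comm 2 1, pd_comm 3 1, pd_comm 3 2, Fin.reduceEq,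
    if_true, if_false, map_zero]
  ring

lemma xd_hom {k : ℕ} (i j : Fin 4) {P : Pol} (h : P ∈ homogeneousSubmodule (Fin 4) ℝ k) :
    xd i j P ∈ homogeneousSubmodule (Fin 4) ℝ k := by
  rw [mem_homogeneousSubmodule] at *
  rw [xd_apply]
  rcases k with _ | k
  · rw [← totalDegree_zero_iff_isHomogeneous, totalDegree_eq_zero_iff_eq_C] at h
    rw [h, pderiv_C, mul_zero]; apply isHomogeneous_zero
  · have := (isHomogeneous_X ℝ i).mul (h.pderiv (i := j))
    convert this using 1
    simp; omega

/-- Harmonic homogeneous polynomials. -/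
def Har (k : ℕ) : Submodule ℝ Pol := homogeneousSubmodule (Fin 4) ℝ k ⊓ LinearMap.ker lap

lemma A1_mem {k : ℕ} {P : Pol} (h : P ∈ Har k) : A1 P ∈ Har k := by
  refine ⟨?_, ?_⟩
  · exact sub_mem (add_mem (add_mem (neg_mem (xd_hom _ _ h.1)) (xd_hom _ _ h.1))
      (xd_hom _ _ h.1)) (xd_hom _ _ h.1)
  · have := h.2
    simp only [SetLike.mem_coe, LinearMap.mem_ker] at *
    rw [lap_A1, this, map_zero]
lemma A2_mem {k : ℕ} {P : Pol} (h : P ∈ Har k) : A2 P ∈ Har k := by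
  refine ⟨?_, ?_⟩
  · exact add_mem (add_mem (sub_mem (neg_mem (xd_hom _ _ h.1)) (xd_hom _ _ h.1))
      (xd_hom _ _ h.1)) (xd_hom _ _ h.1)
  · have := h.2
    simp only [SetLike.mem_coe, LinearMap.mem_ker] at *
    rw [lap_A2, this, map_zero]
lemma A3_mem {k : ℕ} {P : Pol} (h : P ∈ Har k) : A3 P ∈ Har k := by
  refine ⟨?_, ?_⟩
  · exact add_mem (sub_mem (add_mem (neg_mem (xd_hom _ _ h.1)) (xd_hom _ _ h.1))
      (xd_hom _ _ h.1)) (xd_hom _ _ h.1)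
  · have := h.2
    simp only [SetLike.mem_coe, LinearMap.mem_ker] at *
    rw [lap_A3, this, map_zero]

def B1 (k : ℕ) : Har k →ₗ[ℝ] Har k := A1.restrict (fun _ h => A1_mem h)
def B2 (k : ℕ) : Har k →ₗ[ℝ] Har k := A2.restrict (fun _ h => A2_mem h)
def B3 (k : ℕ) : Har k →ₗ[ℝ] Har k := A3.restrict (fun _ h => A3_mem h)

lemma two_mul_eq (P : Pol) : 2 * P = (2 : ℝ) • P := by
  rw [two_mul, two_smul]

lemma B12 (k : ℕ) (P : Har k) : B1 k (B2 k P) - B2 k (B1 k P) = (2 : ℝ) • B3 k P :=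
  Subtype.ext ((A12 P).trans (two_mul_eq _))
lemma B23 (k : ℕ) (P : Har k) : B2 k (B3 k P) - B3 k (B2 k P) = (2 : ℝ) • B1 k P :=
  Subtype.ext ((A23 P).trans (two_mul_eq _))
lemma B31 (k : ℕ) (P : Har k) : B3 k (B1 k P) - B1 k (B3 k P) = (2 : ℝ) • B2 k P :=
  Subtype.ext ((A31 P).trans (two_mul_eq _))

lemma Bsq (k : ℕ) (P : Har k) : B1 k (B1 k P) + B2 k (B2 k P) + B3 k (B3 k P) =
    (-((k : ℝ) * (k + 2))) • P := by
  apply Subtype.ext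
  refine (Asq P).trans ?_
  have h2 : lap (P : Pol) = 0 := P.2.2
  have h1 : (P : Pol).IsHomogeneous k := P.2.1
  have e : ∑ j, X j * pderiv j (P : Pol) = (k : ℝ) • (P : Pol) := by
    rw [h1.sum_X_mul_pderiv, Nat.cast_smul_eq_nsmul]
  rw [h2, e]
  simp only [Derivation.map_smul, mul_smul_comm, ← Finset.smul_sum, e, two_mul_eq]
  simp only [Submodule.coe_smul, mul_zero]
  module

abbrev W (k : ℕ) := Fin 4 → Har k

def D (k : ℕ) : W k →ₗ[ℝ] W k where
  toFun s := ![B1 k (s 1) + B2 k (s 2) + B3 k (s 3),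
    - B1 k (s 0) + B2 k (s 3) - B3 k (s 2),
    - B1 k (s 3) - B2 k (s 0) + B3 k (s 1),
    B1 k (s 2) - B2 k (s 1) - B3 k (s 0)]
  map_add' s t := by
    ext1 c
    fin_cases c <;> simp <;> abel
  map_smul' r s := by
    ext1 c
    fin_cases c <;> simp <;> module

lemma D_sq (k : ℕ) (s : W k) :
    D k (D k s) = (2 : ℝ) • D k s + ((k : ℝ) * (k + 2)) • s := by
  have h0 := fun c => B12 k (s c)
  have h1 := fun c => B23 k (s c)
  have h2 := fun c => B31 k (s c)
  have h3 := fun c => Bsq k (s c)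
  ext1 c
  fin_cases c
  · simp only [D, LinearMap.coe_mk, AddHom.coe_mk, Pi.add_apply, Pi.smul_apply]
    simp [-smul_add]
    linear_combination (norm := module) h0 3 + h1 1 + h2 2 - h3 0
  · simp only [D, LinearMap.coe_mk, AddHom.coe_mk, Pi.add_apply, Pi.smul_apply]
    simp [-smul_add]
    linear_combination (norm := module) - h0 2 - h1 0 + h2 3 - h3 1
  · simp only [D, LinearMap.coe_mk, AddHom.coe_mk, Pi.add_apply, Pi.smul_apply]
    simp [-smul_add]
    linear_combination (norm := module) h0 1 - h1 3 - h2 0 - h3 2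
  · simp only [D, LinearMap.coe_mk, AddHom.coe_mk, Pi.add_apply, Pi.smul_apply]
    simp [-smul_add]
    linear_combination (norm := module) - h0 0 + h1 2 - h2 1 - h3 3

lemma finrank_map_inj {V U : Type*} [AddCommGroup V] [Module ℝ V] [AddCommGroup U] [Module ℝ U]
    (f : V →ₗ[ℝ] U) (p : Submodule ℝ V) (hf : Function.Injective f) :
    Module.finrank ℝ (p.map f) = Module.finrank ℝ p :=
  (Submodule.equivMapOfInjective f hf p).finrank_eq.symm

lemma trace_of_proj {V : Type*} [AddCommGroup V] [Module ℝ V] [FiniteDimensional ℝ V]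
    (p : Submodule ℝ V) (f : V →ₗ[ℝ] V) (h : LinearMap.IsProj p f) :
    LinearMap.trace ℝ V f = (Module.finrank ℝ p : ℝ) := h.trace

/-! ### Dimension of the harmonic polynomials -/

lemma lap_surj_mono (n : ℕ) : ∀ (s : Fin 4 →₀ ℕ) (c : ℝ), s 1 + s 2 + s 3 = n →
    monomial s c ∈ (homogeneousSubmodule (Fin 4) ℝ (s.degree + 2)).map lap := by
  induction n using Nat.strong_induction_on with
  | _ n ih =>
    intro s c hs
    set a : ℝ := c / ((s 0 + 1) * (s 0 + 2)) with ha
    set t : Fin 4 →₀ ℕ := s + Finsupp.single 0 2 with ht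
    have ht0 : t.degree = s.degree + 2 := by simp [ht]
    have key : lap (monomial t a) = monomial s c
        + (pderiv 1 (pderiv 1 (monomial t a)) + pderiv 2 (pderiv 2 (monomial t a))
          + pderiv 3 (pderiv 3 (monomial t a))) := by
      rw [lap_apply, Fin.sum_univ_four]
      have : pderiv 0 (pderiv 0 (monomial t a)) = monomial s c := by
        rw [pderiv_monomial, pderiv_monomial]
        congr 1
        · congr 1
          ext i
          simp [ht]
          by_cases hi : (0 : Fin 4) = i
          · subst hi; simp
          · simp [hi, Finsupp.single_apply]
        · simp [ht, ha]
          field_simp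
      rw [this]; ring
    have hmem : ∀ i : Fin 4, i ≠ 0 → pderiv i (pderiv i (monomial t a)) ∈
        (homogeneousSubmodule (Fin 4) ℝ (s.degree + 2)).map lap := by
      intro i hi
      rw [pderiv_monomial, pderiv_monomial]
      by_cases h2 : 2 ≤ s i
      · set u : Fin 4 →₀ ℕ := t - Finsupp.single i 1 - Finsupp.single i 1 with hu
        have hut : u + Finsupp.single i 2 = t := by
          ext j
          by_cases hj : i = j
          · subst hj
            simp [hu, ht, Finsupp.single_apply, Ne.symm hi]; omega
          · simp [hu, hj]
        have hud : u.degree = s.degree := by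
          have := congrArg Finsupp.degree hut
          simp [ht0] at this
          exact this
        rw [← hud]
        have hlt : u 1 + u 2 + u 3 < n := by
          have e1 := DFunLike.congr_fun hut 1
          have e2 := DFunLike.congr_fun hut 2
          have e3 := DFunLike.congr_fun hut 3
          have e0 := DFunLike.congr_fun hut i
          simp [ht] at e1 e2 e3
          fin_cases i <;> simp [Finsupp.single_apply] at * <;> omega
        exact ih _ hlt u _ rfl
      · have h0 : a * (t i : ℝ) * ((t - Finsupp.single i 1 : Fin 4 →₀ ℕ) i : ℝ) = 0 := by
          have : t i = 0 ∨ (t - Finsupp.single i 1 : Fin 4 →₀ ℕ) i = 0 := by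
            simp [ht, Finsupp.single_apply, Ne.symm hi]; omega
          rcases this with h | h <;> simp [h]
        rw [h0, monomial_zero]
        exact zero_mem _
    have hT : lap (monomial t a) ∈ (homogeneousSubmodule (Fin 4) ℝ (s.degree + 2)).map lap := by
      refine Submodule.mem_map_of_mem ?_
      rw [mem_homogeneousSubmodule]
      exact isHomogeneous_monomial _ ht0
    have : monomial s c = lap (monomial t a) - (pderiv 1 (pderiv 1 (monomial t a))
        + pderiv 2 (pderiv 2 (monomial t a)) + pderiv 3 (pderiv 3 (monomial t a))) := by
      rw [key]; ring
    rw [this]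
    exact sub_mem hT (add_mem (add_mem (hmem 1 (by decide)) (hmem 2 (by decide)))
      (hmem 3 (by decide)))

lemma lap_map (k : ℕ) : (homogeneousSubmodule (Fin 4) ℝ (k + 2)).map lap =
    homogeneousSubmodule (Fin 4) ℝ k := by
  apply le_antisymm
  · rintro _ ⟨P, hP, rfl⟩
    rw [lap_apply]
    refine sum_mem fun i _ => ?_
    exact (IsHomogeneous.pderiv (n := k + 1) (IsHomogeneous.pderiv (n := k + 2) hP))
  · intro Q hQ
    rw [Q.as_sum]
    refine sum_mem fun s hs => ?_
    have hd : s.degree = k := by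
      by_contra h
      exact (mem_support_iff.mp hs) (IsHomogeneous.coeff_eq_zero hQ h)
    rw [← hd]
    exact lap_surj_mono _ s _ rfl

instance (k : ℕ) : Module.Finite ℝ (homogeneousSubmodule (Fin 4) ℝ k) :=
  Module.Finite.iff_fg.mpr (homogeneousSubmodule_fg (Fin 4) ℝ k)

lemma finrank_hom (k : ℕ) :
    Module.finrank ℝ (homogeneousSubmodule (Fin 4) ℝ k) = (k + 3).choose 3 := by
  rw [homogeneousSubmodule_eq_finsupp_supported]
  have hS : {d : Fin 4 →₀ ℕ | d.degree = k} =
      ((Finset.univ : Finset (Fin 4)).finsuppAntidiag k : Set (Fin 4 →₀ ℕ)) := by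
    ext d
    simp [Finset.mem_finsuppAntidiag, Finsupp.degree_eq_sum]
  rw [hS]
  rw [(AddMonoidAlgebra.supportedEquivFinsupp (R := ℝ) (S := ℝ) _).finrank_eq]
  rw [Module.finrank_finsupp_self]
  simp only [SetLike.coe_sort_coe, Fintype.card_coe]
  rw [Finset.card_finsuppAntidiag_nat_eq_choose]
  simp only [Finset.card_univ, Fintype.card_fin]
  rw [show 4 + k - 1 = k + 3 by omega]
  exact (Nat.choose_symm_add)

instance (k : ℕ) : Module.Finite ℝ (Har k) :=
  Module.Finite.of_injective (Submodule.inclusion (inf_le_left :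
    Har k ≤ homogeneousSubmodule (Fin 4) ℝ k)) (Submodule.inclusion_injective _)

lemma choose3 (n : ℕ) : (n + 2).choose 3 * 6 = (n + 2) * (n + 1) * n := by
  induction n with
  | zero => rfl
  | succ n ih =>
    rw [Nat.choose_succ_succ, add_mul, show (n + 1 + 1).choose (2 + 1) = (n + 2).choose 3 from rfl,
      ih]
    have := Nat.choose_two_right (n + 1 + 1)
    have h2 : (n + 1 + 1).choose 2 * 2 = (n + 2) * (n + 1) := by
      rw [this]
      exact Nat.div_mul_cancel (by
        simpa [mul_comm] using (Nat.even_mul_succ_self (n + 1)).two_dvd)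
    nlinarith

lemma finrank_Har (k : ℕ) : Module.finrank ℝ (Har k) = (k + 1) ^ 2 := by
  have gen : ∀ k, Module.finrank ℝ ((homogeneousSubmodule (Fin 4) ℝ k).map lap)
      + Module.finrank ℝ (Har k) = (k + 3).choose 3 := by
    intro k
    have h := LinearMap.finrank_range_add_finrank_ker
      (lap.domRestrict (homogeneousSubmodule (Fin 4) ℝ k))
    rw [finrank_hom, LinearMap.range_domRestrict, LinearMap.ker_domRestrict] at h
    rw [← h]
    congr 1
    have : Har k = ((LinearMap.ker lap).submoduleOf (homogeneousSubmodule (Fin 4) ℝ k)).map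
        (homogeneousSubmodule (Fin 4) ℝ k).subtype := by
      rw [Submodule.submoduleOf, Submodule.map_comap_subtype]; rfl
    rw [this]
    exact finrank_map_inj _ _ (Submodule.subtype_injective _)
  have low : ∀ k, k < 2 → (homogeneousSubmodule (Fin 4) ℝ k).map lap = ⊥ := by
    intro k hk
    rw [eq_bot_iff]
    rintro _ ⟨P, hP, rfl⟩
    rw [Submodule.mem_bot, lap_apply]
    refine Finset.sum_eq_zero fun i _ => ?_
    have h1 : (pderiv i P).IsHomogeneous 0 := by
      have := IsHomogeneous.pderiv (i := i) hP
      rwa [show k - 1 = 0 by omega] at this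
    rw [← totalDegree_zero_iff_isHomogeneous, totalDegree_eq_zero_iff_eq_C] at h1
    rw [h1, pderiv_C]
  have g := gen k
  rcases k with _ | _ | k
  · rw [low _ (by norm_num), finrank_bot] at g
    simpa using g
  · rw [low _ (by norm_num), finrank_bot] at g
    simpa [Nat.choose] using g
  · rw [lap_map, finrank_hom] at g
    have c1 := choose3 (k + 1)
    have c2 := choose3 (k + 3)
    rw [show k + 1 + 1 + 3 = k + 3 + 2 by ring] at g
    rw [show k + 1 + 2 = k + 3 by ring] at c1
    nlinarith

/-! ### Trace and eigenspaces -/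

lemma trace_D (k : ℕ) : LinearMap.trace ℝ (W k) (D k) = 0 := by
  classical
  let b := Module.finBasis ℝ (Har k)
  rw [LinearMap.trace_eq_matrix_trace ℝ (Pi.basis fun _ : Fin 4 => b)]
  rw [Matrix.trace]
  refine Finset.sum_eq_zero fun x _ => ?_
  obtain ⟨c, i⟩ := x
  rw [Matrix.diag_apply, LinearMap.toMatrix_apply, Pi.basis_apply, Pi.basis_repr]
  have : D k (Pi.single c (b i)) c = 0 := by
    fin_cases c <;> simp [D]
  rw [this]; simp

def Em (k : ℕ) : Submodule ℝ (W k) := LinearMap.ker (D k + (k : ℝ) • LinearMap.id)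
def Ep (k : ℕ) : Submodule ℝ (W k) := LinearMap.ker (D k - ((k : ℝ) + 2) • LinearMap.id)

lemma mem_Em (k : ℕ) (s : W k) : s ∈ Em k ↔ D k s = (-(k : ℝ)) • s := by
  have h : (-(k : ℝ)) • s = -((k : ℝ) • s) := by
    funext c; exact neg_smul (k : ℝ) (s c)
  rw [h]
  simp [Em, LinearMap.mem_ker, add_eq_zero_iff_eq_neg]
lemma mem_Ep (k : ℕ) (s : W k) : s ∈ Ep k ↔ D k s = ((k : ℝ) + 2) • s := by
  simp [Ep, LinearMap.mem_ker, sub_eq_zero]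

def Pm (k : ℕ) : W k →ₗ[ℝ] W k :=
  (2 * (k : ℝ) + 2)⁻¹ • (((k : ℝ) + 2) • LinearMap.id + (-1 : ℝ) • D k)
def Pp (k : ℕ) : W k →ₗ[ℝ] W k :=
  (2 * (k : ℝ) + 2)⁻¹ • (D k + (k : ℝ) • LinearMap.id)

lemma Pm_add_Pp (k : ℕ) (s : W k) : Pm k s + Pp k s = s := by
  have : (2 * (k : ℝ) + 2) ≠ 0 := by positivity
  simp only [Pm, Pp, LinearMap.smul_apply, LinearMap.add_apply,
    LinearMap.id_apply]
  match_scalars <;> field_simp <;> ring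

lemma Pm_mem (k : ℕ) (s : W k) : Pm k s ∈ Em k := by
  rw [mem_Em]
  simp only [Pm, LinearMap.smul_apply, LinearMap.add_apply, LinearMap.id_apply, map_smul, map_add,
    D_sq]
  module
lemma Pp_mem (k : ℕ) (s : W k) : Pp k s ∈ Ep k := by
  rw [mem_Ep]
  simp only [Pp, LinearMap.smul_apply, LinearMap.add_apply, LinearMap.id_apply, map_smul, map_add,
    D_sq]
  module

lemma Pm_proj (k : ℕ) : LinearMap.IsProj (Em k) (Pm k) := by
  refine ⟨Pm_mem k, fun s hs => ?_⟩
  have : (2 * (k : ℝ) + 2) ≠ 0 := by positivity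
  rw [mem_Em] at hs
  simp only [Pm, LinearMap.smul_apply, LinearMap.add_apply, LinearMap.id_apply, hs]
  match_scalars; field_simp; ring
lemma Pp_proj (k : ℕ) : LinearMap.IsProj (Ep k) (Pp k) := by
  refine ⟨Pp_mem k, fun s hs => ?_⟩
  have : (2 * (k : ℝ) + 2) ≠ 0 := by positivity
  rw [mem_Ep] at hs
  simp only [Pp, LinearMap.smul_apply, LinearMap.add_apply, LinearMap.id_apply, hs]
  match_scalars; field_simp; ring

lemma finrank_W (k : ℕ) : (Module.finrank ℝ (W k) : ℝ) = 4 * ((k : ℝ) + 1) ^ 2 := by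
  rw [Module.finrank_pi_fintype]
  simp [finrank_Har]

lemma finrank_Em (k : ℕ) : Module.finrank ℝ (Em k) = 2 * (k + 1) * (k + 2) := by
  have h := trace_of_proj _ _ (Pm_proj k)
  have h0 : (2 * (k : ℝ) + 2) ≠ 0 := by positivity
  simp only [Pm, map_smul, map_add, trace_D, LinearMap.trace_id, finrank_W] at h
  have : (Module.finrank ℝ (Em k) : ℝ) = 2 * (k + 1) * (k + 2) := by
    rw [← h]; simp only [smul_eq_mul]; field_simp; ring
  exact_mod_cast this
lemma finrank_Ep (k : ℕ) : Module.finrank ℝ (Ep k) = 2 * k * (k + 1) := by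
  have h := trace_of_proj _ _ (Pp_proj k)
  have h0 : (2 * (k : ℝ) + 2) ≠ 0 := by positivity
  simp only [Pp, map_smul, map_add, trace_D, LinearMap.trace_id, finrank_W] at h
  have : (Module.finrank ℝ (Ep k) : ℝ) = 2 * k * (k + 1) := by
    rw [← h]; simp only [smul_eq_mul]; field_simp; ring
  exact_mod_cast this

lemma inf_E (k : ℕ) : Em k ⊓ Ep k = ⊥ := by
  rw [eq_bot_iff]
  rintro s ⟨h1, h2⟩
  have h1 := (mem_Em k s).1 h1
  have h2 := (mem_Ep k s).1 h2
  rw [h1] at h2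
  have h3 : (2 * (k : ℝ) + 2) • s = 0 := by
    have := sub_eq_zero.mpr h2.symm
    rw [← this]; module
  have h0 : (2 * (k : ℝ) + 2) ≠ 0 := by positivity
  exact (smul_eq_zero.mp h3).resolve_left h0

lemma sup_E (k : ℕ) : Em k ⊔ Ep k = ⊤ := by
  rw [eq_top_iff]
  intro s _
  rw [← Pm_add_Pp k s]
  exact Submodule.add_mem_sup (Pm_mem k s) (Pp_mem k s)

/-! ### Transfer to functions -/

lemma coords_inj {x y : ℍ[ℝ]} (h : coords x = coords y) : x = y := by
  have h0 := congrFun h 0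
  have h1 := congrFun h 1
  have h2 := congrFun h 2
  have h3 := congrFun h 3
  simp [coords] at h0 h1 h2 h3
  exact Quaternion.ext _ _ h0 h1 h2 h3

def toFn (k : ℕ) : W k →ₗ[ℝ] (ℍ[ℝ] → ℍ[ℝ]) where
  toFun s := fun x => ⟨eval (coords x) (s 0 : Pol), eval (coords x) (s 1 : Pol),
    eval (coords x) (s 2 : Pol), eval (coords x) (s 3 : Pol)⟩
  map_add' s t := by
    funext x
    apply Quaternion.ext
    · exact map_add (eval (coords x)) (s 0 : Pol) (t 0 : Pol)
    · exact map_add (eval (coords x)) (s 1 : Pol) (t 1 : Pol)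
    · exact map_add (eval (coords x)) (s 2 : Pol) (t 2 : Pol)
    · exact map_add (eval (coords x)) (s 3 : Pol) (t 3 : Pol)
  map_smul' r s := by
    funext x
    apply Quaternion.ext
    · exact smul_eval (coords x) (s 0 : Pol) r
    · exact smul_eval (coords x) (s 1 : Pol) r
    · exact smul_eval (coords x) (s 2 : Pol) r
    · exact smul_eval (coords x) (s 3 : Pol) r

lemma toFn_re (k : ℕ) (s : W k) (x : ℍ[ℝ]) : (toFn k s x).re = eval (coords x) (s 0 : Pol) := rfl
lemma toFn_imI (k : ℕ) (s : W k) (x : ℍ[ℝ]) : (toFn k s x).imI = eval (coords x) (s 1 : Pol) := rfl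
lemma toFn_imJ (k : ℕ) (s : W k) (x : ℍ[ℝ]) : (toFn k s x).imJ = eval (coords x) (s 2 : Pol) := rfl
lemma toFn_imK (k : ℕ) (s : W k) (x : ℍ[ℝ]) : (toFn k s x).imK = eval (coords x) (s 3 : Pol) := rfl

lemma e1_re : e1.re = 0 := rfl
lemma e1_imI : e1.imI = 1 := rfl
lemma e1_imJ : e1.imJ = 0 := rfl
lemma e1_imK : e1.imK = 0 := rfl
lemma e2_re : e2.re = 0 := rfl
lemma e2_imI : e2.imI = 0 := rfl
lemma e2_imJ : e2.imJ = 1 := rfl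
lemma e2_imK : e2.imK = 0 := rfl
lemma e3_re : e3.re = 0 := rfl
lemma e3_imI : e3.imI = 0 := rfl
lemma e3_imJ : e3.imJ = 0 := rfl
lemma e3_imK : e3.imK = 1 := rfl

lemma coords_toFn (k : ℕ) (s : W k) (x : ℍ[ℝ]) (c : Fin 4) :
    coords (toFn k s x) c = eval (coords x) (s c : Pol) := by
  fin_cases c <;> rfl

lemma coords_mk (v : Fin 4 → ℝ) : coords ⟨v 0, v 1, v 2, v 3⟩ = v := by
  funext c; fin_cases c <;> rfl

lemma toFn_inj (k : ℕ) : Function.Injective (toFn k) := by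
  intro s t h
  funext c
  apply Subtype.ext
  apply MvPolynomial.funext
  intro v
  have := congrArg (fun f => coords (f ⟨v 0, v 1, v 2, v 3⟩) c) h
  have h2 := (coords_toFn k s _ c).symm.trans (this.trans (coords_toFn k t _ c))
  rw [coords_mk] at h2
  exact h2

lemma memVk_iff (k : ℕ) (σ : ℍ[ℝ] → ℍ[ℝ]) : memVk k σ ↔ ∃ s, toFn k s = σ := by
  constructor
  · intro h
    choose P h1 h2 h3 using h
    refine ⟨fun c => ⟨P c, h1 c, ?_⟩, ?_⟩
    · simpa [lap_apply] using h2 c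
    · funext x
      apply coords_inj
      funext c
      rw [coords_toFn, ← h3]
  · rintro ⟨s, rfl⟩ c
    refine ⟨s c, (s c).2.1, ?_, fun x => (coords_toFn k s x c).symm⟩
    have : lap (s c : Pol) = 0 := (s c).2.2
    rwa [lap_apply] at this

/-- coordinates as continuous linear maps -/
def cl (c : Fin 4) : ℍ[ℝ] →L[ℝ] ℝ :=
  LinearMap.toContinuousLinearMap
    { toFun := fun x => coords x c
      map_add' := fun x y => by fin_cases c <;> simp [coords]
      map_smul' := fun r x => by fin_cases c <;> simp [coords] }

lemma cl_apply (c : Fin 4) (x : ℍ[ℝ]) : cl c x = coords x c := rfl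

lemma hasFDerivAt_eval (P : Pol) (x : ℍ[ℝ]) :
    HasFDerivAt (fun y : ℍ[ℝ] => eval (coords y) P)
      (∑ j, eval (coords x) (pderiv j P) • cl j) x := by
  induction P using MvPolynomial.induction_on with
  | C a => simpa using hasFDerivAt_const a x
  | add p q hp hq =>
    have := hp.add hq
    simp only [map_add, add_smul, Finset.sum_add_distrib]
    exact this
  | mul_X p i hp =>
    have hX : HasFDerivAt (fun y : ℍ[ℝ] => coords y i) (cl i) x := (cl i).hasFDerivAt
    have := hp.mul hX
    simp only [map_mul, eval_X]
    refine HasFDerivAt.congr_fderiv this ?_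
    simp only [Derivation.leibniz, pderiv_X, smul_eq_mul, map_add, map_mul, eval_X, add_smul,
      Finset.sum_add_distrib, Finset.smul_sum, mul_smul]
    congr 1
    rw [Finset.sum_eq_single i]
    · simp
    · intro j _ hj
      simp [Ne.symm hj]
    · simp

lemma fderiv_toFn (k : ℕ) (s : W k) (x : ℍ[ℝ]) (v : ℍ[ℝ]) :
    fderiv ℝ (toFn k s) x v =
      (∑ j, eval (coords x) (pderiv j (s 0 : Pol)) * coords v j) • (1 : ℍ[ℝ]) +
      (∑ j, eval (coords x) (pderiv j (s 1 : Pol)) * coords v j) • e1 +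
      (∑ j, eval (coords x) (pderiv j (s 2 : Pol)) * coords v j) • e2 +
      (∑ j, eval (coords x) (pderiv j (s 3 : Pol)) * coords v j) • e3 := by
  have hf : toFn k s = fun y => eval (coords y) (s 0 : Pol) • (1 : ℍ[ℝ])
      + eval (coords y) (s 1 : Pol) • e1 + eval (coords y) (s 2 : Pol) • e2
      + eval (coords y) (s 3 : Pol) • e3 := by
    funext y
    apply Quaternion.ext <;> simp [toFn_re, toFn_imI, toFn_imJ, toFn_imK, e1_re, e1_imI, e1_imJ, e1_imK, e2_re, e2_imI, e2_imJ, e2_imK, e3_re, e3_imI,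
      e3_imJ, e3_imK]
  have h := ((((hasFDerivAt_eval (s 0 : Pol) x).smul_const (1 : ℍ[ℝ])).add
    ((hasFDerivAt_eval (s 1 : Pol) x).smul_const e1)).add
    ((hasFDerivAt_eval (s 2 : Pol) x).smul_const e2)).add
    ((hasFDerivAt_eval (s 3 : Pol) x).smul_const e3)
  rw [hf]
  erw [h.fderiv]
  simp [cl_apply]

lemma coords_mul_e1 (x : ℍ[ℝ]) : coords (x * e1) = ![-x.imI, x.re, x.imK, -x.imJ] := by
  funext c
  fin_cases c <;> simp [coords, e1_re, e1_imI, e1_imJ, e1_imK, e2_re, e2_imI, e2_imJ, e2_imK, e3_re, e3_imI,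
      e3_imJ, e3_imK]
lemma coords_mul_e2 (x : ℍ[ℝ]) : coords (x * e2) = ![-x.imJ, -x.imK, x.re, x.imI] := by
  funext c
  fin_cases c <;> simp [coords, e1_re, e1_imI, e1_imJ, e1_imK, e2_re, e2_imI, e2_imJ, e2_imK, e3_re, e3_imI,
      e3_imJ, e3_imK]
lemma coords_mul_e3 (x : ℍ[ℝ]) : coords (x * e3) = ![-x.imK, x.imJ, -x.imI, x.re] := by
  funext c
  fin_cases c <;> simp [coords, e1_re, e1_imI, e1_imJ, e1_imK, e2_re, e2_imI, e2_imJ, e2_imK, e3_re, e3_imI,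
      e3_imJ, e3_imK]

lemma D_0 (k : ℕ) (s : W k) : ((D k s 0 : Har k) : Pol) =
    A1 (s 1) + A2 (s 2) + A3 (s 3) := rfl
lemma D_1 (k : ℕ) (s : W k) : ((D k s 1 : Har k) : Pol) =
    - A1 (s 0) + A2 (s 3) - A3 (s 2) := rfl
lemma D_2 (k : ℕ) (s : W k) : ((D k s 2 : Har k) : Pol) =
    - A1 (s 3) - A2 (s 0) + A3 (s 1) := rfl
lemma D_3 (k : ℕ) (s : W k) : ((D k s 3 : Har k) : Pol) =
    A1 (s 2) - A2 (s 1) - A3 (s 0) := rfl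

lemma coords_0 (x : ℍ[ℝ]) : coords x 0 = x.re := rfl
lemma coords_1 (x : ℍ[ℝ]) : coords x 1 = x.imI := rfl
lemma coords_2 (x : ℍ[ℝ]) : coords x 2 = x.imJ := rfl
lemma coords_3 (x : ℍ[ℝ]) : coords x 3 = x.imK := rfl

lemma Dbar_toFn (k : ℕ) (s : W k) : Dbar (toFn k s) = toFn k (D k s) := by
  funext x
  simp only [Dbar, Lop, fderiv_toFn, coords_mul_e1, coords_mul_e2, coords_mul_e3,
    Fin.sum_univ_four]
  apply Quaternion.ext <;>
    simp [toFn_re, toFn_imI, toFn_imJ, toFn_imK, D_0, D_1, D_2, D_3, A1_apply, A2_apply, A3_apply,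
      coords_0, coords_1, coords_2, coords_3,
      e1_re, e1_imI, e1_imJ, e1_imK, e2_re, e2_imI, e2_imJ, e2_imK, e3_re, e3_imI,
      e3_imJ, e3_imK] <;> ring

lemma Eminus_eq (k : ℕ) : EminusSet k = ((Em k).map (toFn k) : Set (ℍ[ℝ] → ℍ[ℝ])) := by
  ext σ
  simp only [EminusSet, Set.mem_ofPred_eq, memVk_iff, SetLike.mem_coe, Submodule.mem_map, mem_Em]
  constructor
  · rintro ⟨⟨s, rfl⟩, h⟩
    exact ⟨s, toFn_inj k (by rw [← Dbar_toFn, h, map_smul]), rfl⟩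
  · rintro ⟨s, h, rfl⟩
    exact ⟨⟨s, rfl⟩, by rw [Dbar_toFn, h, map_smul]⟩

lemma Eplus_eq (k : ℕ) : EplusSet k = ((Ep k).map (toFn k) : Set (ℍ[ℝ] → ℍ[ℝ])) := by
  ext σ
  simp only [EplusSet, Set.mem_ofPred_eq, memVk_iff, SetLike.mem_coe, Submodule.mem_map, mem_Ep]
  constructor
  · rintro ⟨⟨s, rfl⟩, h⟩
    exact ⟨s, toFn_inj k (by rw [← Dbar_toFn, h, map_smul]), rfl⟩
  · rintro ⟨s, h, rfl⟩
    exact ⟨⟨s, rfl⟩, by rw [Dbar_toFn, h, map_smul]⟩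

lemma Vk_eq (k : ℕ) : VkSet k = ((⊤ : Submodule ℝ (W k)).map (toFn k) : Set (ℍ[ℝ] → ℍ[ℝ])) := by
  ext σ
  simp only [VkSet, Set.mem_ofPred_eq, memVk_iff, SetLike.mem_coe, Submodule.mem_map,
    Submodule.mem_top, true_and]

/-- `V_k` is the direct sum of the eigenspaces `E₋` and `E₊` of `D̄`, which have real
dimensions `2(k+1)(k+2)` and `2k(k+1)` respectively.  (The sets `E₋`, `E₊` and `V_k` are
real subspaces, i.e. coincide with their real spans; the spans of `E₋` and `E₊` intersect
trivially and together span `V_k`.) -/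
theorem Vk_direct_sum_of_Dbar_eigenspaces (k : ℕ) :
    (Submodule.span ℝ (EminusSet k) : Set (ℍ[ℝ] → ℍ[ℝ])) = EminusSet k ∧
    (Submodule.span ℝ (EplusSet k) : Set (ℍ[ℝ] → ℍ[ℝ])) = EplusSet k ∧
    (Submodule.span ℝ (VkSet k) : Set (ℍ[ℝ] → ℍ[ℝ])) = VkSet k ∧
    Submodule.span ℝ (EminusSet k) ⊓ Submodule.span ℝ (EplusSet k) = ⊥ ∧
    Submodule.span ℝ (EminusSet k) ⊔ Submodule.span ℝ (EplusSet k)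
      = Submodule.span ℝ (VkSet k) ∧
    Module.finrank ℝ (Submodule.span ℝ (EminusSet k)) = 2 * (k + 1) * (k + 2) ∧
    Module.finrank ℝ (Submodule.span ℝ (EplusSet k)) = 2 * k * (k + 1) := by
  rw [Eminus_eq, Eplus_eq, Vk_eq]
  simp only [Submodule.span_eq]
  refine ⟨trivial, trivial, trivial, ?_, ?_, ?_, ?_⟩
  · rw [← Submodule.map_inf _ (toFn_inj k), inf_E, Submodule.map_bot]
  · rw [← Submodule.map_sup, sup_E]
  · rw [Submodule.span_eq, finrank_map_inj _ _ (toFn_inj k), finrank_Em]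
  · rw [Submodule.span_eq, finrank_map_inj _ _ (toFn_inj k), finrank_Ep]

end
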